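/- Every graph on n vertices admits an orientation that is ⌊2n/3⌋-quasi-oriented-antimagic. -/

import Mathlib

/-- `D` is an orientation of the simple graph `G`: a directed graph
whose underlying undirected graph is `G`. -/
def IsOrientation {V : Type*} (G : SimpleGraph V) (D : V → V → Prop) : Prop :=
  (∀ u w : V, G.Adj u w ↔ (D u w ∨ D w u)) ∧ (∀ u w : V, ¬(D u w ∧ D w u))

open Classical in
/-- The oriented vertex sum at `v`: the sum of the labels of edges oriented toward `v`
minus the sum of the labels of edges oriented away from `v`. -/
noncomputable def orientedSum {V : Type*} [Fintype V] (G : SimpleGraph V)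
    (D : V → V → Prop) (f : Sym2 V → ℕ) (v : V) : ℤ :=
  ∑ w ∈ (G.neighborSet v).toFinite.toFinset,
    if D w v then (f s(v, w) : ℤ) else -(f s(v, w) : ℤ)

/-- `G` admits an orientation that is `k`-quasi-oriented-antimagic: there is an
orientation `D` of `G` and an injective edge labeling into `{1, …, |E(G)| + k}`
such that the oriented vertex sums are pairwise distinct over all vertices of
degree at least `1`. -/
def HasQuasiOrientedAntimagicOrientation {V : Type*} [Fintype V]
    (G : SimpleGraph V) (k : ℕ) : Prop :=
  ∃ D : V → V → Prop, IsOrientation G D ∧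
    ∃ f : Sym2 V → ℕ,
      (∀ e ∈ G.edgeSet, f e ∈ Finset.Icc 1 (Nat.card G.edgeSet + k)) ∧
      (∀ e₁ ∈ G.edgeSet, ∀ e₂ ∈ G.edgeSet, e₁ ≠ e₂ → f e₁ ≠ f e₂) ∧
      (∀ u w : V, u ≠ w →
        1 ≤ Nat.card (G.neighborSet u) → 1 ≤ Nat.card (G.neighborSet w) →
        orientedSum G D f u ≠ orientedSum G D f w)

theorem card_add_card_le_of_sub_mem {A B F R C : Finset ℤ} (c : ℤ)
    (hA : A.Nonempty) (hB : B.Nonempty)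
    (hrow : ∀ a ∈ A, c + a - B.max' hB ∈ F ∨ a ∈ R)
    (hcol : ∀ b ∈ B, c + A.max' hA - b ∈ F ∨ b ∈ C) :
    A.card + B.card ≤ F.card + R.card + C.card + 1 := by
  classical
  set a₀ := A.max' hA
  set b₀ := B.max' hB
  have h1 : ((A \ R).image (fun a => c + a - b₀)).card = (A \ R).card :=
    Finset.card_image_of_injective _ fun x y h => by omega
  have h2 : ((B \ C).image (fun b => c + a₀ - b)).card = (B \ C).card :=
    Finset.card_image_of_injective _ fun x y h => by omega
  have h3 : (A \ R).image (fun a => c + a - b₀) ∪ (B \ C).image (fun b => c + a₀ - b) ⊆ F := by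
    intro v hv
    simp only [Finset.mem_union, Finset.mem_image, Finset.mem_sdiff] at hv
    rcases hv with ⟨a, ⟨ha, hr⟩, rfl⟩ | ⟨b, ⟨hb, hr⟩, rfl⟩
    · exact (hrow a ha).resolve_right hr
    · exact (hcol b hb).resolve_right hr
  have h4 : (A \ R).image (fun a => c + a - b₀) ∩ (B \ C).image (fun b => c + a₀ - b)
      ⊆ {c + a₀ - b₀} := by
    intro v hv
    simp only [Finset.mem_inter, Finset.mem_image, Finset.mem_sdiff] at hv
    obtain ⟨⟨a, ⟨ha, -⟩, rfl⟩, b, ⟨hb, -⟩, h⟩ := hv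
    have := A.le_max' a ha
    have := B.le_max' b hb
    simp only [Finset.mem_singleton]
    omega
  have h5 := Finset.card_le_card h3
  have h6 := Finset.card_le_card h4
  have h7 := Finset.card_union_add_card_inter ((A \ R).image (fun a => c + a - b₀))
    ((B \ C).image (fun b => c + a₀ - b))
  have h8 := Finset.le_card_sdiff R A
  have h9 := Finset.le_card_sdiff C B
  simp only [Finset.card_singleton] at h6
  omega

theorem card_le_card_filter_add_card {S F : Finset ℤ} (φ : ℤ → ℤ) (hφ : φ.Injective) :
    S.card ≤ {x ∈ S | φ x ∉ F}.card + F.card := by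
  have h1 := Finset.card_filter_add_card_filter_not (s := S) (fun x => φ x ∈ F)
  have h2 : {x ∈ S | φ x ∈ F}.card ≤ F.card :=
    Finset.card_le_card_of_injOn φ (fun x hx => (Finset.mem_filter.1 hx).2) hφ.injOn
  omega

theorem exists_path_labels {S F : Finset ℤ} (a₁ a₂ a₃ a₄ : ℤ)
    (h : 4 * F.card + 30 ≤ 3 * S.card) :
    ∃ x ∈ S, ∃ y ∈ S, ∃ z ∈ S, (x ≠ y ∧ x ≠ -y ∧ x ≠ z ∧ x ≠ -z ∧ y ≠ z ∧ y ≠ -z) ∧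
      (a₁ - x ∉ F ∧ a₂ + x - y ∉ F ∧ a₃ + y - z ∉ F ∧ a₄ + z ∉ F) ∧
      a₁ - x ≠ a₂ + x - y ∧ a₁ - x ≠ a₃ + y - z ∧ a₁ - x ≠ a₄ + z ∧
      a₂ + x - y ≠ a₃ + y - z ∧ a₂ + x - y ≠ a₄ + z ∧ a₃ + y - z ≠ a₄ + z := by
  classical
  set X : Finset ℤ := {x ∈ S | a₁ - x ∉ F} with hX
  set Z : Finset ℤ := {z ∈ S | a₄ + z ∉ F} with hZ
  have hXc : S.card ≤ X.card + F.card :=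
    card_le_card_filter_add_card _ fun x y h => by omega
  have hZc : S.card ≤ Z.card + F.card :=
    card_le_card_filter_add_card _ fun x y h => by omega
  have hZne : Z.Nonempty := Finset.card_pos.1 (by omega)
  set w := Z.max' hZne with hw
  have hwZ : w ∈ Z := Z.max'_mem hZne
  set X' : Finset ℤ := X \ {w, -w, a₁ - a₄ - w} with hX'
  have hX'c : X.card ≤ X'.card + 3 := by
    have h1 := Finset.le_card_sdiff {w, -w, a₁ - a₄ - w} X
    have h2 : ({w, -w, a₁ - a₄ - w} : Finset ℤ).card ≤ 3 := Finset.card_le_three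
    rw [← hX'] at h1
    omega
  have hX'ne : X'.Nonempty := Finset.card_pos.1 (by omega)
  have hmemX' : ∀ x ∈ X', (x ∈ S ∧ a₁ - x ∉ F) ∧ x ≠ w ∧ x ≠ -w ∧ x ≠ a₁ - a₄ - w := by
    intro x hx
    simpa [hX', hX] using hx
  let ok : ℤ → ℤ → Prop := fun x y => a₂ + x - y ∉ F ∧ x ≠ y ∧ x ≠ -y ∧
    a₁ - x ≠ a₂ + x - y ∧ a₁ - x ≠ a₃ + y - w ∧ a₂ + x - y ≠ a₄ + w ∧ a₂ + x - y ≠ a₃ + y - w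
  set Y : Finset ℤ := {y ∈ S | ∃ x ∈ X', ok x y} with hY
  set B : Finset ℤ := {y ∈ S | ¬ ∃ x ∈ X', ok x y} with hB
  have hYB : Y.card + B.card = S.card := Finset.card_filter_add_card_filter_not _
  have hBc : B.Nonempty → X'.card + B.card ≤ F.card + 13 := by
    intro hBne
    have hbad : ∀ x ∈ X', ∀ y ∈ B, ¬ ok x y := fun x hx y hy h' =>
      (Finset.mem_filter.1 hy).2 ⟨x, hx, h'⟩
    set b := B.max' hBne
    set p := X'.max' hX'ne
    have key := card_add_card_le_of_sub_mem (F := F)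
      (R := [b, -b, (a₁ - a₂ + b) / 2, a₁ - a₃ - b + w, a₄ + w - a₂ + b,
        a₃ + b - w - a₂ + b].toFinset)
      (C := [p, -p, a₂ + p + p - a₁, a₁ - p - a₃ + w, a₂ + p - a₄ - w,
        (a₂ + p - a₃ + w) / 2].toFinset) a₂ hX'ne hBne
      (by
        intro x hx
        have := hbad x hx b (B.max'_mem _)
        simp only [List.mem_toFinset, List.mem_cons, List.not_mem_nil, or_false]
        by_contra! hcon
        exact this ⟨hcon.1, by omega, by omega, by omega, by omega, by omega, by omega⟩)
      (by
        intro y hy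
        have := hbad p (X'.max'_mem _) y hy
        simp only [List.mem_toFinset, List.mem_cons, List.not_mem_nil, or_false]
        by_contra! hcon
        exact this ⟨hcon.1, by omega, by omega, by omega, by omega, by omega, by omega⟩)
    refine key.trans ?_
    have h1 := List.toFinset_card_le [b, -b, (a₁ - a₂ + b) / 2, a₁ - a₃ - b + w, a₄ + w - a₂ + b,
        a₃ + b - w - a₂ + b]
    have h2 := List.toFinset_card_le [p, -p, a₂ + p + p - a₁, a₁ - p - a₃ + w, a₂ + p - a₄ - w,
        (a₂ + p - a₃ + w) / 2]
    simp only [List.length_cons, List.length_nil] at h1 h2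
    omega
  have hYne : Y.Nonempty := by
    rw [Finset.nonempty_iff_ne_empty]
    intro hY0
    rw [hY0, Finset.card_empty] at hYB
    have := hBc (Finset.card_pos.1 (by omega))
    omega
  have hYc : F.card + 13 < Y.card + Z.card := by
    rcases B.eq_empty_or_nonempty with hB0 | hBne
    · rw [hB0, Finset.card_empty] at hYB
      omega
    · have := hBc hBne
      omega
  by_contra hcon
  have hbad : ∀ y ∈ Y, ∀ x ∈ X', ok x y → ∀ z ∈ Z, ¬ (a₃ + y - z ∉ F ∧ x ≠ z ∧ x ≠ -z ∧ y ≠ z ∧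
      y ≠ -z ∧ a₁ - x ≠ a₃ + y - z ∧ a₁ - x ≠ a₄ + z ∧ a₂ + x - y ≠ a₃ + y - z ∧
      a₂ + x - y ≠ a₄ + z ∧ a₃ + y - z ≠ a₄ + z) := by
    rintro y hy x hx ⟨o1, o2, o3, o4, -⟩ z hz ⟨c1, c2, c3, c4, c5, c6, c7, c8, c9, c10⟩
    obtain ⟨⟨hxS, hxF⟩, -⟩ := hmemX' x hx
    obtain ⟨hzS, hzF⟩ := Finset.mem_filter.1 hz
    exact hcon ⟨x, hxS, y, (Finset.mem_filter.1 hy).1, z, hzS, ⟨o2, o3, c2, c3, c4, c5⟩,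
      ⟨hxF, o1, c1, hzF⟩, o4, c6, c7, c8, c9, c10⟩
  set b := Y.max' hYne
  have hbY : b ∈ Y := Y.max'_mem _
  obtain ⟨x, hx, hxb⟩ := (Finset.mem_filter.1 hbY).2
  have key := card_add_card_le_of_sub_mem (F := F)
    (R := [w, -w, a₄ + w + w - a₃].toFinset)
    (C := [x, -x, b, -b, a₃ + b - a₁ + x, a₁ - x - a₄, a₃ + b - a₂ - x + b, a₂ + x - b - a₄,
      (a₃ + b - a₄) / 2].toFinset) a₃ hYne hZne
    (by
      intro y hy
      obtain ⟨x, hx, hxy⟩ := (Finset.mem_filter.1 hy).2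
      have := hbad y hy x hx hxy w hwZ
      obtain ⟨-, d1, d2, d3⟩ := hmemX' x hx
      obtain ⟨-, -, -, -, o5, o6, o7⟩ := hxy
      simp only [List.mem_toFinset, List.mem_cons, List.not_mem_nil, or_false]
      by_contra! hc
      exact this ⟨hc.1, by omega, by omega, by omega, by omega, by omega, by omega, by omega,
        by omega, by omega⟩)
    (by
      intro z hz
      have := hbad b hbY x hx hxb z hz
      simp only [List.mem_toFinset, List.mem_cons, List.not_mem_nil, or_false]
      by_contra! hc
      exact this ⟨hc.1, by omega, by omega, by omega, by omega, by omega, by omega, by omega,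
        by omega, by omega⟩)
  have h1 := List.toFinset_card_le [w, -w, a₄ + w + w - a₃]
  have h2 := List.toFinset_card_le [x, -x, b, -b, a₃ + b - a₁ + x, a₁ - x - a₄,
    a₃ + b - a₂ - x + b, a₂ + x - b - a₄, (a₃ + b - a₄) / 2]
  simp only [List.length_cons, List.length_nil] at h1 h2
  omega

theorem exists_triangle_labels_of_card_le {S F : Finset ℤ} (a₁ a₂ a₃ w : ℤ)
    (h : 2 * F.card + 16 < 2 * S.card)
    (hw : {x ∈ S | a₁ + x - w ∈ F}.card + {y ∈ S | a₃ + w - y ∈ F}.card ≤ F.card + 1) :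
    ∃ x ∈ S, ∃ y ∈ S, (x ≠ y ∧ x ≠ -y ∧ x ≠ w ∧ x ≠ -w ∧ y ≠ w ∧ y ≠ -w) ∧
      (a₁ + x - w ∉ F ∧ a₂ + y - x ∉ F ∧ a₃ + w - y ∉ F) ∧
      a₁ + x - w ≠ a₂ + y - x ∧ a₁ + x - w ≠ a₃ + w - y ∧ a₂ + y - x ≠ a₃ + w - y := by
  classical
  set X : Finset ℤ := {x ∈ S | a₁ + x - w ∉ F} \ {w, -w} with hX
  set Y : Finset ℤ := {y ∈ S | a₃ + w - y ∉ F} \ {w, -w} with hY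
  have h2 : ({w, -w} : Finset ℤ).card ≤ 2 := Finset.card_le_two
  have hXc := Finset.le_card_sdiff {w, -w} {x ∈ S | a₁ + x - w ∉ F}
  have hYc := Finset.le_card_sdiff {w, -w} {y ∈ S | a₃ + w - y ∉ F}
  have hX1 := Finset.card_filter_add_card_filter_not (s := S) (fun x => a₁ + x - w ∈ F)
  have hY1 := Finset.card_filter_add_card_filter_not (s := S) (fun y => a₃ + w - y ∈ F)
  have hXS : X ⊆ S := Finset.sdiff_subset.trans (Finset.filter_subset _ _)
  have hYS : Y ⊆ S := Finset.sdiff_subset.trans (Finset.filter_subset _ _)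
  have hXS' := Finset.card_le_card hXS
  have hYS' := Finset.card_le_card hYS
  rw [← hX] at hXc
  rw [← hY] at hYc
  have hXne : X.Nonempty := Finset.card_pos.1 (by omega)
  have hYne : Y.Nonempty := Finset.card_pos.1 (by omega)
  by_contra hcon
  have hbad : ∀ y ∈ Y, ∀ x ∈ X, ¬ (a₂ + y - x ∉ F ∧ x ≠ y ∧ x ≠ -y ∧ a₁ + x - w ≠ a₂ + y - x ∧
      a₁ + x - w ≠ a₃ + w - y ∧ a₂ + y - x ≠ a₃ + w - y) := by
    rintro y hy x hx ⟨c1, c2, c3, c4, c5, c6⟩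
    have hx' : (x ∈ S ∧ a₁ + x - w ∉ F) ∧ x ≠ w ∧ x ≠ -w := by simpa [hX] using hx
    have hy' : (y ∈ S ∧ a₃ + w - y ∉ F) ∧ y ≠ w ∧ y ≠ -w := by simpa [hY] using hy
    exact hcon ⟨x, hx'.1.1, y, hy'.1.1, ⟨c2, c3, hx'.2.1, hx'.2.2, hy'.2.1, hy'.2.2⟩,
      ⟨hx'.1.2, c1, hy'.1.2⟩, c4, c5, c6⟩
  set p := X.max' hXne
  set b := Y.max' hYne
  have key := card_add_card_le_of_sub_mem (F := F)
    (R := [p, -p, a₁ + p - w - a₂ + p, a₃ + w - a₁ - p + w, (a₃ + w - a₂ + p) / 2].toFinset)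
    (C := [b, -b, (a₂ + b - a₁ + w) / 2, a₃ + w - b - a₁ + w, a₂ + b - a₃ - w + b].toFinset)
    a₂ hYne hXne
    (by
      intro y hy
      have := hbad y hy p (X.max'_mem _)
      simp only [List.mem_toFinset, List.mem_cons, List.not_mem_nil, or_false]
      by_contra! hc
      exact this ⟨hc.1, by omega, by omega, by omega, by omega, by omega⟩)
    (by
      intro x hx
      have := hbad b (Y.max'_mem _) x hx
      simp only [List.mem_toFinset, List.mem_cons, List.not_mem_nil, or_false]
      by_contra! hc
      exact this ⟨hc.1, by omega, by omega, by omega, by omega, by omega⟩)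
  have h1 := List.toFinset_card_le
    [p, -p, a₁ + p - w - a₂ + p, a₃ + w - a₁ - p + w, (a₃ + w - a₂ + p) / 2]
  have h2 := List.toFinset_card_le
    [b, -b, (a₂ + b - a₁ + w) / 2, a₃ + w - b - a₁ + w, a₂ + b - a₃ - w + b]
  simp only [List.length_cons, List.length_nil] at h1 h2
  omega

theorem exists_triangle_labels {S F : Finset ℤ} (a₁ a₂ a₃ : ℤ)
    (h : 2 * F.card + 16 < 2 * S.card) :
    ∃ x ∈ S, ∃ y ∈ S, ∃ w ∈ S, (x ≠ y ∧ x ≠ -y ∧ x ≠ w ∧ x ≠ -w ∧ y ≠ w ∧ y ≠ -w) ∧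
      (a₁ + x - w ∉ F ∧ a₂ + y - x ∉ F ∧ a₃ + w - y ∉ F) ∧
      a₁ + x - w ≠ a₂ + y - x ∧ a₁ + x - w ≠ a₃ + w - y ∧ a₂ + y - x ≠ a₃ + w - y := by
  classical
  have hS : S.Nonempty := Finset.card_pos.1 (by omega)
  suffices ∃ w ∈ S,
      {x ∈ S | a₁ + x - w ∈ F}.card + {y ∈ S | a₃ + w - y ∈ F}.card ≤ F.card + 1 by
    obtain ⟨w, hwS, hw⟩ := this
    obtain ⟨x, hx, y, hy, hxy⟩ := exists_triangle_labels_of_card_le a₁ a₂ a₃ w h hw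
    exact ⟨x, hx, y, hy, w, hwS, hxy⟩
  have hle : ∀ c : ℤ, {φ ∈ F | φ ≤ c}.card + {φ ∈ F | c ≤ φ}.card ≤ F.card + 1 := by
    intro c
    rw [← Finset.card_union_add_card_inter]
    refine Nat.add_le_add (Finset.card_le_card (Finset.union_subset (Finset.filter_subset _ _)
      (Finset.filter_subset _ _))) ((Finset.card_le_card (t := {c}) fun φ hφ => ?_).trans_eq
        (Finset.card_singleton c))
    simp only [Finset.mem_inter, Finset.mem_filter] at hφ
    simp only [Finset.mem_singleton]
    omega
  have hmax : ∀ x ∈ S, x ≤ S.max' hS := fun x hx => S.le_max' x hx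
  have hmin : ∀ x ∈ S, S.min' hS ≤ x := fun x hx => S.min'_le x hx
  have e1 : {x ∈ S | a₁ + x - S.max' hS ∈ F}.card ≤ {φ ∈ F | φ ≤ a₁}.card :=
    Finset.card_le_card_of_injOn (fun x => a₁ + x - S.max' hS)
      (fun x hx => by
        have hx := Finset.mem_filter.1 hx
        have := hmax x hx.1
        exact Finset.mem_coe.2 (Finset.mem_filter.2 ⟨hx.2, by dsimp only; omega⟩))
      (fun x _ y _ h => by simp only at h; omega)
  have e2 : {x ∈ S | a₁ + x - S.min' hS ∈ F}.card ≤ {φ ∈ F | a₁ ≤ φ}.card :=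
    Finset.card_le_card_of_injOn (fun x => a₁ + x - S.min' hS)
      (fun x hx => by
        have hx := Finset.mem_filter.1 hx
        have := hmin x hx.1
        exact Finset.mem_coe.2 (Finset.mem_filter.2 ⟨hx.2, by dsimp only; omega⟩))
      (fun x _ y _ h => by simp only at h; omega)
  have e3 : {y ∈ S | a₃ + S.max' hS - y ∈ F}.card ≤ {φ ∈ F | a₃ ≤ φ}.card :=
    Finset.card_le_card_of_injOn (fun y => a₃ + S.max' hS - y)
      (fun x hx => by
        have hx := Finset.mem_filter.1 hx
        have := hmax x hx.1
        exact Finset.mem_coe.2 (Finset.mem_filter.2 ⟨hx.2, by dsimp only; omega⟩))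
      (fun x _ y _ h => by simp only at h; omega)
  have e4 : {y ∈ S | a₃ + S.min' hS - y ∈ F}.card ≤ {φ ∈ F | φ ≤ a₃}.card :=
    Finset.card_le_card_of_injOn (fun y => a₃ + S.min' hS - y)
      (fun x hx => by
        have hx := Finset.mem_filter.1 hx
        have := hmin x hx.1
        exact Finset.mem_coe.2 (Finset.mem_filter.2 ⟨hx.2, by dsimp only; omega⟩))
      (fun x _ y _ h => by simp only at h; omega)
  have l1 := hle a₁
  have l3 := hle a₃
  rcases le_total ({φ ∈ F | φ ≤ a₁}.card + {φ ∈ F | a₃ ≤ φ}.card) (F.card + 1) with hm | hm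
  · exact ⟨_, S.max'_mem hS, by omega⟩
  · exact ⟨_, S.min'_mem hS, by omega⟩

theorem exists_signed_labels (L : Finset ℕ) (hL : 0 ∉ L) :
    ∃ S : Finset ℤ, S.card = 2 * L.card ∧ ∀ x ∈ S, x.natAbs ∈ L := by
  classical
  refine ⟨L.image (fun l : ℕ => (l : ℤ)) ∪ L.image (fun l : ℕ => -(l : ℤ)), ?_, ?_⟩
  · rw [Finset.card_union_of_disjoint, Finset.card_image_of_injective, Finset.card_image_of_injective,
      two_mul]
    · intro x y h
      simpa using h
    · intro x y h
      simpa using h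
    · rw [Finset.disjoint_left]
      intro x hx hx'
      obtain ⟨l, hl, rfl⟩ := Finset.mem_image.1 hx
      obtain ⟨l', hl', h⟩ := Finset.mem_image.1 hx'
      have : l = 0 := by omega
      exact hL (this ▸ hl)
  · intro x hx
    rcases Finset.mem_union.1 hx with h | h <;> obtain ⟨l, hl, rfl⟩ := Finset.mem_image.1 h <;>
      simpa using hl

section EdgeSign

variable {V : Type*}

open Classical in
/-- The signed incidence of `v` with `e`, for a fixed reference orientation of every edge:
`1` at one endpoint of `e`, `-1` at the other and `0` elsewhere. -/
noncomputable def edgeSign (e : Sym2 V) (v : V) : ℤ :=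
  if v = (Quot.out e).1 then 1 else if v = (Quot.out e).2 then -1 else 0

theorem edgeSign_of_notMem {e : Sym2 V} {v : V} (h : v ∉ e) : edgeSign e v = 0 := by
  have h1 : v ≠ (Quot.out e).1 := fun h' => h (h' ▸ Sym2.out_fst_mem e)
  have h2 : v ≠ (Quot.out e).2 := fun h' => h (h' ▸ Sym2.out_snd_mem e)
  simp [edgeSign, h1, h2]

theorem edgeSign_mk {u w : V} (h : u ≠ w) :
    (edgeSign s(u, w) u = 1 ∧ edgeSign s(u, w) w = -1) ∨
      (edgeSign s(u, w) u = -1 ∧ edgeSign s(u, w) w = 1) := by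
  have h' : s((Quot.out s(u, w)).1, (Quot.out s(u, w)).2) = s(u, w) := Quot.out_eq _
  rcases Sym2.eq_iff.1 h' with ⟨h1, h2⟩ | ⟨h1, h2⟩
  · left
    simp [edgeSign, h1, h2, h.symm]
  · right
    simp [edgeSign, h1, h2, h]

theorem edgeSign_mul_self {e : Sym2 V} {v : V} (he : ¬ e.IsDiag) (h : v ∈ e) :
    edgeSign e v * edgeSign e v = 1 := by
  obtain ⟨w, rfl⟩ := h
  have hvw : v ≠ w := fun h' => he (by simpa using h')
  rcases edgeSign_mk hvw with ⟨h1, -⟩ | ⟨h1, -⟩ <;> simp [h1]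

theorem natAbs_mul_edgeSign {e : Sym2 V} {v : V} (he : ¬ e.IsDiag) (h : v ∈ e) (x : ℤ) :
    (x * edgeSign e v).natAbs = x.natAbs := by
  obtain ⟨w, rfl⟩ := h
  have hvw : v ≠ w := fun h' => he (by simpa using h')
  rcases edgeSign_mk hvw with ⟨h1, -⟩ | ⟨h1, -⟩ <;> simp [h1]

theorem edgeSign_right {u w : V} (h : u ≠ w) : edgeSign s(u, w) w = -edgeSign s(u, w) u := by
  rcases edgeSign_mk h with ⟨h1, h2⟩ | ⟨h1, h2⟩ <;> simp [h1, h2]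

/-- The vertex sum at `v` of the signed labeling `g` of the edges in `A`, with initial weights
`a`. -/
noncomputable def weightedSum (a : V → ℤ) (A : Finset (Sym2 V)) (g : Sym2 V → ℤ) (v : V) : ℤ :=
  a v + ∑ e ∈ A, g e * edgeSign e v

/-- Every edge in `A` has both endpoints in `U`. -/
def EdgesWithin (A : Finset (Sym2 V)) (U : Finset V) : Prop :=
  ∀ e ∈ A, ¬ e.IsDiag ∧ ∀ v ∈ e, v ∈ U

theorem sum_edgeSign_eq_zero {A : Finset (Sym2 V)} {U : Finset V} (h : EdgesWithin A U)
    (g : Sym2 V → ℤ) {v : V} (hv : v ∉ U) : ∑ e ∈ A, g e * edgeSign e v = 0 :=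
  Finset.sum_eq_zero fun e he => by
    rw [edgeSign_of_notMem fun hve => hv ((h e he).2 v hve), mul_zero]

/-- For all initial weights, all sets `F` of forbidden sums and all sets `L` of labels of the
indicated sizes, the edges in `A` can be given signed labels with distinct absolute values in `L`
so that the sums at the vertices in `U` are distinct and not in `F`. -/
def Completable (n k : ℕ) (A : Finset (Sym2 V)) (U : Finset V) : Prop :=
  ∀ (a : V → ℤ) (F : Finset ℤ) (L : Finset ℕ), 0 ∉ L → F.card + U.card ≤ n →
    A.card + k ≤ L.card → ∃ g : Sym2 V → ℤ, (∀ e ∈ A, (g e).natAbs ∈ L) ∧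
      Set.InjOn (fun e => (g e).natAbs) A ∧ Set.InjOn (weightedSum a A g) U ∧
      ∀ v ∈ U, weightedSum a A g v ∉ F

variable {n k : ℕ} {A A' : Finset (Sym2 V)} {U U' : Finset V}

theorem completable_empty : Completable n k (∅ : Finset (Sym2 V)) ∅ := by
  intro a F L _ _ _
  exact ⟨0, by simp⟩

variable [DecidableEq V]

theorem weightedSum_insert (a : V → ℤ) {A : Finset (Sym2 V)} (g : Sym2 V → ℤ) {e : Sym2 V}
    (he : e ∉ A) (x : ℤ) (v : V) :
    weightedSum a (insert e A) (Function.update g e x) v =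
      weightedSum (fun v => a v + x * edgeSign e v) A g v := by
  unfold weightedSum
  rw [Finset.sum_insert he, Function.update_self, add_assoc]
  congr 2
  refine Finset.sum_congr rfl fun e' he' => ?_
  rw [Function.update_of_ne (by rintro rfl; exact he he')]

theorem update_labels {L : Finset ℕ} {g : Sym2 V → ℤ} {e : Sym2 V} {x : ℤ}
    (he : e ∉ A) (hx : x.natAbs ∈ L) (hg : ∀ e ∈ A, (g e).natAbs ∈ L.erase x.natAbs)
    (hinj : Set.InjOn (fun e => (g e).natAbs) A) :
    (∀ e' ∈ insert e A, (Function.update g e x e').natAbs ∈ L) ∧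
      Set.InjOn (fun e' => (Function.update g e x e').natAbs) (insert e A : Finset (Sym2 V)) := by
  have hne : ∀ e' ∈ A, Function.update g e x e' = g e' := fun e' he' =>
    Function.update_of_ne (by rintro rfl; exact he he') _ _
  refine ⟨fun e' he' => ?_, ?_⟩
  · rcases Finset.mem_insert.1 he' with rfl | he'
    · simpa using hx
    · rw [hne e' he']
      exact Finset.mem_of_mem_erase (hg e' he')
  · rw [Finset.coe_insert, Set.injOn_insert (by simpa using he)]
    refine ⟨fun e₁ h₁ e₂ h₂ h => hinj h₁ h₂ ?_, ?_⟩
    · simpa only [hne e₁ h₁, hne e₂ h₂] using h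
    · rintro ⟨e', he', h⟩
      simp only [hne e' he', Function.update_self] at h
      exact Finset.ne_of_mem_erase (hg e' he') h

theorem Completable.insert_edge (h : Completable n k A U) {e : Sym2 V} (he : e ∉ A) :
    Completable n k (insert e A) U := by
  intro a F L h0 hF hL
  rw [Finset.card_insert_of_notMem he] at hL
  obtain ⟨x, hx⟩ : L.Nonempty := Finset.card_pos.1 (by omega)
  obtain ⟨g, hg, hinj, hU, hUF⟩ := h (fun v => a v + x * edgeSign e v) F (L.erase x)
    (fun h' => h0 (Finset.mem_of_mem_erase h')) hF (by rw [Finset.card_erase_of_mem hx]; omega)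
  obtain ⟨h1, h2⟩ := update_labels (x := (x : ℤ)) he (by simpa using hx) (by simpa using hg) hinj
  refine ⟨Function.update g e x, h1, h2, ?_, ?_⟩
  · intro u hu v hv huv
    simp only [weightedSum_insert a g he] at huv
    exact hU hu hv huv
  · intro v hv
    rw [weightedSum_insert a g he]
    exact hUF v hv

theorem Completable.insert_vertex (hnk : 2 * n ≤ 3 * k + 2) (h : Completable n k A U)
    (hA : EdgesWithin A U) {v w : V} (hvw : v ≠ w) (hv : v ∉ U) :
    Completable n k (insert s(v, w) A) (insert v U) := by
  intro a F L h0 hF hL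
  have he : s(v, w) ∉ A := fun he => hv ((hA _ he).2 v (by simp))
  rw [Finset.card_insert_of_notMem he] at hL
  rw [Finset.card_insert_of_notMem hv] at hF
  obtain ⟨S, hSc, hS⟩ := exists_signed_labels L h0
  have hsq := edgeSign_mul_self (e := s(v, w)) (v := v) (by simpa using hvw) (by simp)
  have hc := card_le_card_filter_add_card (S := S) (F := F)
    (fun x => a v + x * edgeSign s(v, w) v) (fun x y hxy => by
      simp only [add_right_inj] at hxy
      calc x = x * edgeSign s(v, w) v * edgeSign s(v, w) v := by rw [mul_assoc, hsq, mul_one]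
        _ = y := by rw [hxy, mul_assoc, hsq, mul_one])
  obtain ⟨x, hx⟩ : {x ∈ S | a v + x * edgeSign s(v, w) v ∉ F}.Nonempty :=
    Finset.card_pos.1 (by omega)
  obtain ⟨hxS, hxF⟩ := Finset.mem_filter.1 hx
  obtain ⟨g, hg, hinj, hU, hUF⟩ := h (fun u => a u + x * edgeSign s(v, w) u)
    (insert (a v + x * edgeSign s(v, w) v) F) (L.erase x.natAbs)
    (fun h' => h0 (Finset.mem_of_mem_erase h')) (by rw [Finset.card_insert_of_notMem hxF]; omega)
    (by rw [Finset.card_erase_of_mem (hS x hxS)]; omega)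
  obtain ⟨h1, h2⟩ := update_labels he (hS x hxS) hg hinj
  have hsum : weightedSum (fun u => a u + x * edgeSign s(v, w) u) A g v =
      a v + x * edgeSign s(v, w) v := by
    rw [weightedSum, sum_edgeSign_eq_zero hA g hv, add_zero]
  refine ⟨Function.update g s(v, w) x, h1, h2, ?_, ?_⟩
  · rw [funext (weightedSum_insert a g he x), Finset.coe_insert, Set.injOn_insert (by simpa using hv)]
    refine ⟨hU, ?_⟩
    rintro ⟨u, hu, hu'⟩
    exact hUF u hu (by rw [hu', hsum]; exact Finset.mem_insert_self _ _)
  · intro u hu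
    rw [weightedSum_insert a g he]
    rcases Finset.mem_insert.1 hu with rfl | hu
    · rwa [hsum]
    · exact fun h' => hUF u hu (Finset.mem_insert_of_mem h')

theorem Completable.union (h : Completable n k A U) (h' : Completable n k A' U')
    (hA : EdgesWithin A U) (hA' : EdgesWithin A' U') (hU : Disjoint U U') :
    Completable n k (A ∪ A') (U ∪ U') := by
  have hdisj : Disjoint A A' := by
    rw [Finset.disjoint_left]
    intro e he he'
    exact Finset.disjoint_left.1 hU ((hA e he).2 _ (Sym2.out_fst_mem e))
      ((hA' e he').2 _ (Sym2.out_fst_mem e))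
  intro a F L h0 hF hL
  rw [Finset.card_union_of_disjoint hU] at hF
  rw [Finset.card_union_of_disjoint hdisj] at hL
  obtain ⟨g, hg, hinj, hgU, hgF⟩ := h a F L h0 (by omega) (by omega)
  have hc1 : (F ∪ U.image (weightedSum a A g)).card ≤ F.card + U.card :=
    (Finset.card_union_le _ _).trans (Nat.add_le_add_left Finset.card_image_le _)
  have hc2 := Finset.le_card_sdiff (A.image fun e => (g e).natAbs) L
  have hc3 : (A.image fun e => (g e).natAbs).card ≤ A.card := Finset.card_image_le
  obtain ⟨g', hg', hinj', hgU', hgF'⟩ := h' a (F ∪ U.image (weightedSum a A g))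
    (L \ A.image fun e => (g e).natAbs) (fun h' => h0 (Finset.mem_sdiff.1 h').1) (by omega)
    (by omega)
  have e1 : ∀ e ∈ A, (if e ∈ A then g e else g' e) = g e := fun e he => if_pos he
  have e2 : ∀ e ∈ A', (if e ∈ A then g e else g' e) = g' e := fun e he =>
    if_neg (Finset.disjoint_right.1 hdisj he)
  have hsum : ∀ v, weightedSum a (A ∪ A') (fun e => if e ∈ A then g e else g' e) v =
      a v + (∑ e ∈ A, g e * edgeSign e v + ∑ e ∈ A', g' e * edgeSign e v) := by
    intro v
    rw [weightedSum, Finset.sum_union hdisj,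
      Finset.sum_congr rfl fun e he => by rw [e1 e he],
      Finset.sum_congr (s₁ := A') rfl fun e he => by rw [e2 e he]]
  have s1 : ∀ v ∈ U, weightedSum a (A ∪ A') (fun e => if e ∈ A then g e else g' e) v =
      weightedSum a A g v := fun v hv => by
    rw [hsum, sum_edgeSign_eq_zero hA' g' (Finset.disjoint_left.1 hU hv), add_zero, weightedSum]
  have s2 : ∀ v ∈ U', weightedSum a (A ∪ A') (fun e => if e ∈ A then g e else g' e) v =
      weightedSum a A' g' v := fun v hv => by
    rw [hsum, sum_edgeSign_eq_zero hA g (Finset.disjoint_right.1 hU hv), zero_add, weightedSum]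
  refine ⟨fun e => if e ∈ A then g e else g' e, ?_, ?_, ?_, ?_⟩
  · intro e he
    rcases Finset.mem_union.1 he with he | he
    · simp only [e1 e he]
      exact hg e he
    · simp only [e2 e he]
      exact (Finset.mem_sdiff.1 (hg' e he)).1
  · rw [Finset.coe_union, Set.injOn_union (Finset.disjoint_coe.2 hdisj)]
    refine ⟨?_, ?_, ?_⟩
    · intro x hx y hy hxy
      simp only [e1 x hx, e1 y hy] at hxy
      exact hinj hx hy hxy
    · intro x hx y hy hxy
      simp only [e2 x hx, e2 y hy] at hxy
      exact hinj' hx hy hxy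
    · intro x hx y hy hxy
      simp only [e1 x hx, e2 y hy] at hxy
      exact (Finset.mem_sdiff.1 (hg' y hy)).2 (Finset.mem_image.2 ⟨x, hx, hxy⟩)
  · rw [Finset.coe_union, Set.injOn_union (Finset.disjoint_coe.2 hU)]
    refine ⟨?_, ?_, ?_⟩
    · intro x hx y hy hxy
      rw [s1 x hx, s1 y hy] at hxy
      exact hgU hx hy hxy
    · intro x hx y hy hxy
      rw [s2 x hx, s2 y hy] at hxy
      exact hgU' hx hy hxy
    · intro x hx y hy hxy
      rw [s1 x hx, s2 y hy] at hxy
      exact hgF' y hy (Finset.mem_union_right _ (Finset.mem_image.2 ⟨x, hx, hxy⟩))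
  · intro v hv
    rcases Finset.mem_union.1 hv with hv | hv
    · rw [s1 v hv]
      exact hgF v hv
    · rw [s2 v hv]
      exact fun h' => hgF' v hv (Finset.mem_union_left _ h')

/-- Labelings of three edges are given by three signed values with the indicated sums. -/
theorem exists_labeling_three {L : Finset ℕ} {e₁ e₂ e₃ : Sym2 V} {x₁ x₂ x₃ : ℤ}
    (h12 : e₁ ≠ e₂) (h13 : e₁ ≠ e₃) (h23 : e₂ ≠ e₃) {u₁ u₂ u₃ : V} (d₁ : ¬ e₁.IsDiag)
    (d₂ : ¬ e₂.IsDiag) (d₃ : ¬ e₃.IsDiag) (m₁ : u₁ ∈ e₁) (m₂ : u₂ ∈ e₂) (m₃ : u₃ ∈ e₃)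
    (hx₁ : x₁.natAbs ∈ L) (hx₂ : x₂.natAbs ∈ L) (hx₃ : x₃.natAbs ∈ L)
    (hx : x₁ ≠ x₂ ∧ x₁ ≠ -x₂ ∧ x₁ ≠ x₃ ∧ x₁ ≠ -x₃ ∧ x₂ ≠ x₃ ∧ x₂ ≠ -x₃) (a : V → ℤ) :
    ∃ g : Sym2 V → ℤ, (∀ e ∈ ({e₁, e₂, e₃} : Finset (Sym2 V)), (g e).natAbs ∈ L) ∧
      Set.InjOn (fun e => (g e).natAbs) ({e₁, e₂, e₃} : Finset (Sym2 V)) ∧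
      ∀ v, weightedSum a {e₁, e₂, e₃} g v = a v + (x₁ * (edgeSign e₁ u₁ * edgeSign e₁ v) +
        x₂ * (edgeSign e₂ u₂ * edgeSign e₂ v) + x₃ * (edgeSign e₃ u₃ * edgeSign e₃ v)) := by
  let g : Sym2 V → ℤ := fun e => if e = e₁ then x₁ * edgeSign e₁ u₁ else
    if e = e₂ then x₂ * edgeSign e₂ u₂ else x₃ * edgeSign e₃ u₃
  have g1 : g e₁ = x₁ * edgeSign e₁ u₁ := if_pos rfl
  have g2 : g e₂ = x₂ * edgeSign e₂ u₂ := by simp [g, h12.symm]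
  have g3 : g e₃ = x₃ * edgeSign e₃ u₃ := by simp [g, h13.symm, h23.symm]
  have n1 : (g e₁).natAbs = x₁.natAbs := by rw [g1, natAbs_mul_edgeSign d₁ m₁]
  have n2 : (g e₂).natAbs = x₂.natAbs := by rw [g2, natAbs_mul_edgeSign d₂ m₂]
  have n3 : (g e₃).natAbs = x₃.natAbs := by rw [g3, natAbs_mul_edgeSign d₃ m₃]
  refine ⟨g, ?_, ?_, ?_⟩
  · intro e he
    simp only [Finset.mem_insert, Finset.mem_singleton] at he
    rcases he with rfl | rfl | rfl
    · rwa [n1]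
    · rwa [n2]
    · rwa [n3]
  · intro e he e' he' h
    simp only [Finset.coe_insert, Finset.coe_singleton, Set.mem_insert_iff,
      Set.mem_singleton_iff] at he he'
    rcases he with rfl | rfl | rfl <;> rcases he' with rfl | rfl | rfl <;>
      first
      | rfl
      | (simp only [n1, n2, n3] at h; omega)
  · intro v
    rw [weightedSum, Finset.sum_insert (by simp [h12, h13]), Finset.sum_insert (by simp [h23]),
      Finset.sum_singleton, g1, g2, g3]
    ring

theorem completable_path (hnk : 2 * n ≤ 3 * k + 2) {v₁ v₂ v₃ v₄ : V} (h12 : v₁ ≠ v₂)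
    (h13 : v₁ ≠ v₃) (h14 : v₁ ≠ v₄) (h23 : v₂ ≠ v₃) (h24 : v₂ ≠ v₄) (h34 : v₃ ≠ v₄) :
    Completable n k {s(v₁, v₂), s(v₂, v₃), s(v₃, v₄)} {v₁, v₂, v₃, v₄} := by
  intro a F L h0 hF hL
  have e1 : s(v₁, v₂) ≠ s(v₂, v₃) := by simp [h12, h13]
  have e2 : s(v₁, v₂) ≠ s(v₃, v₄) := by simp [h13, h14]
  have e3 : s(v₂, v₃) ≠ s(v₃, v₄) := by simp [h23, h24]
  rw [Finset.card_eq_three.2 ⟨_, _, _, e1, e2, e3, rfl⟩] at hL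
  have hU : ({v₁, v₂, v₃, v₄} : Finset V).card = 4 := by simp [h12, h13, h14, h23, h24, h34]
  obtain ⟨S, hSc, hS⟩ := exists_signed_labels L h0
  obtain ⟨x, hx, y, hy, z, hz, hxyz, ⟨f1, f2, f3, f4⟩, d12, d13, d14, d23, d24, d34⟩ :=
    exists_path_labels (S := S) (F := F) (a v₁) (a v₂) (a v₃) (a v₄) (by omega)
  obtain ⟨g, hg, hinj, hsum⟩ := exists_labeling_three e1 e2 e3 (u₁ := v₂) (u₂ := v₃) (u₃ := v₄)
    (by simpa using h12) (by simpa using h23) (by simpa using h34) (by simp) (by simp) (by simp)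
    (hS x hx) (hS y hy) (hS z hz) hxyz a
  have q1 := edgeSign_mul_self (e := s(v₁, v₂)) (v := v₂) (by simpa using h12) (by simp)
  have q2 := edgeSign_mul_self (e := s(v₂, v₃)) (v := v₃) (by simpa using h23) (by simp)
  have q3 := edgeSign_mul_self (e := s(v₃, v₄)) (v := v₄) (by simpa using h34) (by simp)
  have r1 : edgeSign s(v₁, v₂) v₂ * edgeSign s(v₁, v₂) v₁ = -1 := by
    rw [edgeSign_right h12] at q1 ⊢; linarith
  have r2 : edgeSign s(v₂, v₃) v₃ * edgeSign s(v₂, v₃) v₂ = -1 := by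
    rw [edgeSign_right h23] at q2 ⊢; linarith
  have r3 : edgeSign s(v₃, v₄) v₄ * edgeSign s(v₃, v₄) v₃ = -1 := by
    rw [edgeSign_right h34] at q3 ⊢; linarith
  have s1 : weightedSum a {s(v₁, v₂), s(v₂, v₃), s(v₃, v₄)} g v₁ = a v₁ - x := by
    rw [hsum, r1, edgeSign_of_notMem (e := s(v₂, v₃)) (v := v₁) (by simp [h12, h13]),
      edgeSign_of_notMem (e := s(v₃, v₄)) (v := v₁) (by simp [h14, h13])]
    ring
  have s2 : weightedSum a {s(v₁, v₂), s(v₂, v₃), s(v₃, v₄)} g v₂ = a v₂ + x - y := by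
    rw [hsum, q1, r2, edgeSign_of_notMem (e := s(v₃, v₄)) (v := v₂) (by simp [h23, h24])]
    ring
  have s3 : weightedSum a {s(v₁, v₂), s(v₂, v₃), s(v₃, v₄)} g v₃ = a v₃ + y - z := by
    rw [hsum, q2, r3, edgeSign_of_notMem (e := s(v₁, v₂)) (v := v₃) (by simp [h23.symm, h13.symm])]
    ring
  have s4 : weightedSum a {s(v₁, v₂), s(v₂, v₃), s(v₃, v₄)} g v₄ = a v₄ + z := by
    rw [hsum, q3, edgeSign_of_notMem (e := s(v₁, v₂)) (v := v₄) (by simp [h14.symm, h24.symm]),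
      edgeSign_of_notMem (e := s(v₂, v₃)) (v := v₄) (by simp [h34.symm, h24.symm])]
    ring
  refine ⟨g, hg, hinj, ?_, ?_⟩
  · intro u hu w hw h
    simp only [Finset.coe_insert, Finset.coe_singleton, Set.mem_insert_iff,
      Set.mem_singleton_iff] at hu hw
    rcases hu with rfl | rfl | rfl | rfl <;> rcases hw with rfl | rfl | rfl | rfl <;>
      first
      | rfl
      | (rw [s1, s2] at h; omega)
      | (simp only [s1, s2, s3, s4] at h; omega)
  · intro u hu
    simp only [Finset.mem_insert, Finset.mem_singleton] at hu
    rcases hu with rfl | rfl | rfl | rfl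
    · rwa [s1]
    · rwa [s2]
    · rwa [s3]
    · rwa [s4]

theorem completable_triangle (hnk : 2 * n ≤ 3 * k + 2) {v₁ v₂ v₃ : V} (h12 : v₁ ≠ v₂)
    (h13 : v₁ ≠ v₃) (h23 : v₂ ≠ v₃) :
    Completable n k {s(v₁, v₂), s(v₂, v₃), s(v₃, v₁)} {v₁, v₂, v₃} := by
  intro a F L h0 hF hL
  have e1 : s(v₁, v₂) ≠ s(v₂, v₃) := by simp [h12, h13]
  have e2 : s(v₁, v₂) ≠ s(v₃, v₁) := by simp [h13, h23]
  have e3 : s(v₂, v₃) ≠ s(v₃, v₁) := by simp [h23, h12.symm]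
  rw [Finset.card_eq_three.2 ⟨_, _, _, e1, e2, e3, rfl⟩] at hL
  rw [Finset.card_eq_three.2 ⟨_, _, _, h12, h13, h23, rfl⟩] at hF
  obtain ⟨S, hSc, hS⟩ := exists_signed_labels L h0
  obtain ⟨x, hx, y, hy, w, hw, hxyw, ⟨f1, f2, f3⟩, d12, d13, d23⟩ :=
    exists_triangle_labels (S := S) (F := F) (a v₁) (a v₂) (a v₃) (by omega)
  obtain ⟨g, hg, hinj, hsum⟩ := exists_labeling_three e1 e2 e3 (u₁ := v₁) (u₂ := v₂) (u₃ := v₃)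
    (by simpa using h12) (by simpa using h23) (by simpa using h13.symm) (by simp) (by simp)
    (by simp) (hS x hx) (hS y hy) (hS w hw) hxyw a
  have q1 := edgeSign_mul_self (e := s(v₁, v₂)) (v := v₁) (by simpa using h12) (by simp)
  have q2 := edgeSign_mul_self (e := s(v₂, v₃)) (v := v₂) (by simpa using h23) (by simp)
  have q3 := edgeSign_mul_self (e := s(v₃, v₁)) (v := v₃) (by simpa using h13.symm) (by simp)
  have r1 : edgeSign s(v₁, v₂) v₁ * edgeSign s(v₁, v₂) v₂ = -1 := by
    rw [edgeSign_right h12]; linarith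
  have r2 : edgeSign s(v₂, v₃) v₂ * edgeSign s(v₂, v₃) v₃ = -1 := by
    rw [edgeSign_right h23]; linarith
  have r3 : edgeSign s(v₃, v₁) v₃ * edgeSign s(v₃, v₁) v₁ = -1 := by
    rw [edgeSign_right h13.symm]; linarith
  have s1 : weightedSum a {s(v₁, v₂), s(v₂, v₃), s(v₃, v₁)} g v₁ = a v₁ + x - w := by
    rw [hsum, q1, r3, edgeSign_of_notMem (e := s(v₂, v₃)) (v := v₁) (by simp [h12, h13])]
    ring
  have s2 : weightedSum a {s(v₁, v₂), s(v₂, v₃), s(v₃, v₁)} g v₂ = a v₂ + y - x := by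
    rw [hsum, q2, r1, edgeSign_of_notMem (e := s(v₃, v₁)) (v := v₂) (by simp [h12.symm, h23])]
    ring
  have s3 : weightedSum a {s(v₁, v₂), s(v₂, v₃), s(v₃, v₁)} g v₃ = a v₃ + w - y := by
    rw [hsum, q3, r2, edgeSign_of_notMem (e := s(v₁, v₂)) (v := v₃) (by simp [h13.symm, h23.symm])]
    ring
  refine ⟨g, hg, hinj, ?_, ?_⟩
  · intro u hu w hw h
    simp only [Finset.coe_insert, Finset.coe_singleton, Set.mem_insert_iff,
      Set.mem_singleton_iff] at hu hw
    rcases hu with rfl | rfl | rfl <;> rcases hw with rfl | rfl | rfl <;>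
      first
      | rfl
      | (simp only [s1, s2, s3] at h; omega)
  · intro u hu
    simp only [Finset.mem_insert, Finset.mem_singleton] at hu
    rcases hu with rfl | rfl | rfl
    · rwa [s1]
    · rwa [s2]
    · rwa [s3]

end EdgeSign

theorem exists_star_labels {V : Type*} [Fintype V] [DecidableEq V] (Lf : Finset V) (par : V → V) :
    ∃ r : V → ℕ, (∀ l ∈ Lf, 1 ≤ r l ∧ r l ≤ Lf.card) ∧ Set.InjOn r Lf ∧
      ∀ c c', c ≠ c' → {l ∈ Lf | par l = c}.Nonempty → {l ∈ Lf | par l = c'}.Nonempty →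
        ∑ l ∈ Lf with par l = c, r l ≠ ∑ l ∈ Lf with par l = c', r l := by
  let idx : V → ℕ := fun v => Fintype.equivFin V v
  have hidx : idx.Injective := Fin.val_injective.comp (Fintype.equivFin V).injective
  let d : V → ℕ := fun c => {l ∈ Lf | par l = c}.card
  let key : V → ℕ ×ₗ ℕ ×ₗ ℕ := fun l => toLex (d (par l), toLex (idx (par l), idx l))
  have hkey : key.Injective := fun x y h => by
    simp only [key, EmbeddingLike.apply_eq_iff_eq, Prod.mk.injEq] at h
    exact hidx h.2.2
  let r : V → ℕ := fun l => {x ∈ Lf | key x ≤ key l}.card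
  have hr : ∀ l l', l' ∈ Lf → key l < key l' → r l < r l' := fun l l' hl' h => by
    refine Finset.card_lt_card (Finset.ssubset_iff_of_subset ?_ |>.2 ⟨l', ?_, ?_⟩)
    · exact Finset.monotone_filter_right _ fun x _ hx => hx.trans h.le
    · simpa using hl'
    · simp [hl', h]
  have hsum : ∀ c c', toLex (d c, idx c) < toLex (d c', idx c') →
      {l ∈ Lf | par l = c}.Nonempty → {l ∈ Lf | par l = c'}.Nonempty →
        ∑ l ∈ Lf with par l = c, r l < ∑ l ∈ Lf with par l = c', r l := by
    intro c c' hcc hc hc'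
    obtain ⟨m, hm, hmin⟩ := Finset.exists_min_image _ r hc'
    obtain ⟨hm1, hm2⟩ := Finset.mem_filter.1 hm
    calc ∑ l ∈ Lf with par l = c, r l < ∑ l ∈ Lf with par l = c, r m := by
          refine Finset.sum_lt_sum_of_nonempty hc fun l hl => hr l m hm1 ?_
          obtain ⟨hl1, hl2⟩ := Finset.mem_filter.1 hl
          simp only [Prod.Lex.toLex_lt_toLex] at hcc
          simp only [key, hm2, hl2, Prod.Lex.toLex_lt_toLex]
          tauto
      _ = d c * r m := by simp [d]
      _ ≤ d c' * r m := by
          refine Nat.mul_le_mul_right _ ?_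
          rw [Prod.Lex.toLex_lt_toLex] at hcc
          omega
      _ ≤ ∑ l ∈ Lf with par l = c', r l := by
          simpa [d] using Finset.card_nsmul_le_sum _ _ (r m) hmin
  refine ⟨r, fun l hl => ⟨Finset.card_pos.2 ⟨l, by simpa using hl⟩,
    Finset.card_filter_le _ _⟩, fun l hl l' hl' h => ?_, fun c c' hcc hc hc' => ?_⟩
  · by_contra hne
    rcases lt_or_gt_of_ne (hkey.ne hne) with h' | h'
    · exact (hr l l' hl' h').ne h
    · exact (hr l' l hl h').ne h.symm
  · rcases lt_or_gt_of_ne (a := toLex (d c, idx c)) (b := toLex (d c', idx c'))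
      (fun h => hcc (hidx (by simpa using (congrArg (fun x => (ofLex x).2) h)))) with h | h
    · exact (hsum c c' h hc hc').ne
    · exact (hsum c' c h hc' hc).ne'

section Graph

variable {V : Type*} [Fintype V] (G : SimpleGraph V) [DecidableRel G.Adj]

/-- The vertex sum at `v` of the signed labeling `g` of the edges of `G`. -/
noncomputable def vertexSum (g : Sym2 V → ℤ) (v : V) : ℤ :=
  ∑ w ∈ G.neighborFinset v, g s(v, w) * edgeSign s(v, w) v

theorem vertexSum_congr {g g' : Sym2 V → ℤ} {v : V}
    (h : ∀ w, G.Adj v w → g s(v, w) = g' s(v, w)) : vertexSum G g v = vertexSum G g' v :=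
  Finset.sum_congr rfl fun w hw => by rw [h w (by simpa using hw)]

theorem HasQuasiOrientedAntimagicOrientation.of_signed {k : ℕ} (g : Sym2 V → ℤ)
    (hg : ∀ e ∈ G.edgeFinset, (g e).natAbs ∈ Finset.Icc 1 (G.edgeFinset.card + k))
    (hinj : Set.InjOn (fun e => (g e).natAbs) G.edgeFinset)
    (hsum : ∀ u w, u ≠ w → (∃ x, G.Adj u x) → (∃ x, G.Adj w x) →
      vertexSum G g u ≠ vertexSum G g w) :
    HasQuasiOrientedAntimagicOrientation G k := by
  let D : V → V → Prop := fun u w => G.Adj u w ∧ 0 < g s(u, w) * edgeSign s(u, w) w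
  have hD : ∀ u w, G.Adj u w → (D w u ↔ ¬ D u w) ∧
      (if D w u then ((g s(u, w)).natAbs : ℤ) else -((g s(u, w)).natAbs : ℤ)) =
        g s(u, w) * edgeSign s(u, w) u := by
    intro u w h
    have h0 : g s(u, w) ≠ 0 := by
      have := hg s(u, w) (by simpa using h)
      simp only [Finset.mem_Icc] at this
      omega
    simp only [D, h, h.symm, true_and, Sym2.eq_swap (a := w) (b := u)]
    rcases edgeSign_mk h.ne with ⟨h1, h2⟩ | ⟨h1, h2⟩ <;> rw [h1, h2] <;>
      refine ⟨by omega, ?_⟩ <;> split_ifs <;> omega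
  have hos : ∀ v, orientedSum G D (fun e => (g e).natAbs) v = vertexSum G g v := by
    intro v
    unfold orientedSum vertexSum
    refine Finset.sum_congr (by ext; simp) fun w hw => ?_
    rw [← (hD v w (by simpa using hw)).2]
    congr
  have hcard : Nat.card G.edgeSet = G.edgeFinset.card := by
    rw [Nat.card_eq_fintype_card, SimpleGraph.edgeFinset_card]
  have hdeg : ∀ v, 1 ≤ Nat.card (G.neighborSet v) → ∃ x, G.Adj v x := fun v hv => by
    obtain ⟨⟨x, hx⟩⟩ := (Nat.card_pos_iff.1 hv).1
    exact ⟨x, hx⟩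
  refine ⟨D, ⟨fun u w => ⟨fun h => ?_, ?_⟩, fun u w h => ?_⟩, fun e => (g e).natAbs, ?_, ?_, ?_⟩
  · have := (hD u w h).1
    tauto
  · rintro (h | h)
    exacts [h.1, h.1.symm]
  · exact (hD u w h.1.1).1.1 h.2 h.1
  · intro e he
    rw [hcard]
    exact hg e (by simpa using he)
  · intro e he e' he' hne h
    exact hne (hinj (by simpa using he) (by simpa using he') h)
  · intro u w hne hu hw
    rw [hos, hos]
    exact hsum u w hne (hdeg u hu) (hdeg w hw)

variable [DecidableEq V]

/-- A maximal completable set of edges of `G`: outside its vertex set, `G` is a star forest. -/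
theorem exists_completable_of_star_complement {n k : ℕ} (hnk : 2 * n ≤ 3 * k + 2) :
    ∃ (A : Finset (Sym2 V)) (U : Finset V), A ⊆ G.edgeFinset ∧ EdgesWithin A U ∧
      Completable n k A U ∧ (∀ v w, G.Adj v w → v ∈ U → w ∈ U ∧ s(v, w) ∈ A) ∧
      ∀ v w, G.Adj v w → v ∉ U → (∀ x, G.Adj v x → x = w) ∨ ∀ x, G.Adj w x → x = v := by
  classical
  obtain ⟨⟨A, U⟩, hmem, hmax⟩ := Finset.exists_max_image
    (Finset.univ.filter fun p : Finset (Sym2 V) × Finset V =>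
      p.1 ⊆ G.edgeFinset ∧ EdgesWithin p.1 p.2 ∧ Completable n k p.1 p.2)
    (fun p => p.1.card) ⟨(∅, ∅), Finset.mem_filter.2
      ⟨Finset.mem_univ _, by simp, by simp [EdgesWithin], completable_empty⟩⟩
  simp only [Finset.mem_filter, Finset.mem_univ, true_and] at hmem hmax
  obtain ⟨hAG, hA, hc⟩ := hmem
  have hmax' : ∀ A' U', A ⊆ A' → A' ⊆ G.edgeFinset → EdgesWithin A' U' →
      Completable n k A' U' → A' ⊆ A := fun A' U' h1 h2 h3 h4 =>
    (Finset.eq_of_subset_of_card_le h1 (hmax (A', U') ⟨h2, h3, h4⟩)).ge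
  have hins : ∀ v w, G.Adj v w → ∀ U', U ⊆ U' → v ∈ U' → w ∈ U' →
      EdgesWithin (insert s(v, w) A) U' := by
    intro v w h U' hU hv hw e he
    rcases Finset.mem_insert.1 he with rfl | he
    · refine ⟨by simpa using h.ne, fun x hx => ?_⟩
      rcases Sym2.mem_iff.1 hx with rfl | rfl <;> assumption
    · exact ⟨(hA e he).1, fun x hx => hU ((hA e he).2 x hx)⟩
  have hsub : ∀ v w, G.Adj v w → insert s(v, w) A ⊆ G.edgeFinset := fun v w h =>
    Finset.insert_subset (by simpa using h) hAG
  have hclosed : ∀ v w, G.Adj v w → v ∈ U → w ∈ U := by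
    intro v w h hv
    by_contra hw
    have := hmax' _ _ (Finset.subset_insert _ _) (hsub w v h.symm)
      (hins w v h.symm _ (Finset.subset_insert _ _) (by simp) (by simp [hv]))
      (hc.insert_vertex hnk hA h.ne.symm hw)
    exact hw ((hA _ (this (Finset.mem_insert_self _ _))).2 w (by simp))
  have hinside : ∀ v w, G.Adj v w → v ∈ U → s(v, w) ∈ A := by
    intro v w h hv
    by_contra he
    exact he (hmax' _ _ (Finset.subset_insert _ _) (hsub v w h)
      (hins v w h _ subset_rfl hv (hclosed v w h hv)) (hc.insert_edge he)
      (Finset.mem_insert_self _ _))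
  have hout : ∀ A' U', A'.Nonempty → A' ⊆ G.edgeFinset → EdgesWithin A' U' →
      Completable n k A' U' → Disjoint U U' → False := by
    rintro A' U' ⟨e, he⟩ h1 h2 h3 h4
    have := hmax' (A ∪ A') (U ∪ U') Finset.subset_union_left (Finset.union_subset hAG h1)
      (fun e he => (Finset.mem_union.1 he).elim
        (fun he => ⟨(hA e he).1, fun v hv => Finset.mem_union_left _ ((hA e he).2 v hv)⟩)
        (fun he => ⟨(h2 e he).1, fun v hv => Finset.mem_union_right _ ((h2 e he).2 v hv)⟩))
      (hc.union h3 hA h2 h4)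
    exact Finset.disjoint_left.1 h4
      ((hA e (this (Finset.mem_union_right _ he))).2 _ (Sym2.out_fst_mem e))
      ((h2 e he).2 _ (Sym2.out_fst_mem e))
  refine ⟨A, U, hAG, hA, hc, fun v w h hv => ⟨hclosed v w h hv, hinside v w h hv⟩, ?_⟩
  intro v w h hv
  by_contra! hcon
  obtain ⟨⟨v', hv', hvw⟩, w', hw', hwv⟩ := hcon
  have hw : w ∉ U := fun hw => hv (hclosed _ _ h.symm hw)
  have hv'U : v' ∉ U := fun h' => hv (hclosed _ _ hv'.symm h')
  have hw'U : w' ∉ U := fun h' => hw (hclosed _ _ hw'.symm h')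
  by_cases hne : v' = w'
  · subst hne
    refine hout _ _ ⟨_, Finset.mem_insert_self _ _⟩ ?_ ?_
      (completable_triangle hnk h.ne hv'.ne hw'.ne) ?_
    · intro e he
      simp only [Finset.mem_insert, Finset.mem_singleton] at he
      rcases he with rfl | rfl | rfl <;> simp [h, hv'.symm, hw']
    · intro e he
      simp only [Finset.mem_insert, Finset.mem_singleton] at he
      rcases he with rfl | rfl | rfl <;> simp [h.ne, hv'.ne.symm, hw'.ne]
    · simp [hv, hw, hv'U]
  · refine hout _ _ ⟨_, Finset.mem_insert_self _ _⟩ ?_ ?_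
      (completable_path hnk hv'.ne.symm hvw hne h.ne hwv.symm hw'.ne) ?_
    · intro e he
      simp only [Finset.mem_insert, Finset.mem_singleton] at he
      rcases he with rfl | rfl | rfl <;> simp [h, hv'.symm, hw']
    · intro e he
      simp only [Finset.mem_insert, Finset.mem_singleton] at he
      rcases he with rfl | rfl | rfl <;> simp [h.ne, hv'.ne.symm, hw'.ne]
    · simp [hv, hw, hv'U, hw'U]

/-- A choice of leaves in a star forest, with exactly one of them on each edge. -/
theorem exists_leaves {U : Finset V} (hU : ∀ v w, G.Adj v w → v ∈ U → w ∈ U)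
    (hstar : ∀ v w, G.Adj v w → v ∉ U → (∀ x, G.Adj v x → x = w) ∨ ∀ x, G.Adj w x → x = v) :
    ∃ (Lf : Finset V) (par : V → V), (∀ l ∈ Lf, l ∉ U ∧ par l ∉ Lf ∧ ∀ x, G.Adj l x ↔ x = par l) ∧
      ∀ v w, G.Adj v w → v ∉ U → v ∈ Lf ∨ w ∈ Lf := by
  classical
  let P : V → V → Prop := fun v w => (∀ x, G.Adj v x ↔ x = w) ∧
    ((∃ x, x ≠ v ∧ G.Adj w x) ∨ edgeSign s(v, w) v = 1)
  have hP : ∀ v w, P v w → ∀ y, ¬ P w y := by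
    rintro v w ⟨h1, h2⟩ y ⟨h3, h4⟩
    have hvw : G.Adj v w := (h1 w).2 rfl
    obtain rfl : v = y := (h3 v).1 hvw.symm
    rw [Sym2.eq_swap] at h4
    rcases h2 with ⟨x, hx, hx'⟩ | h2
    · exact hx ((h3 x).1 hx')
    rcases h4 with ⟨x, hx, hx'⟩ | h4
    · exact hx ((h1 x).1 hx')
    rw [edgeSign_right hvw.ne, h2] at h4
    norm_num at h4
  have hP' : ∀ v w, G.Adj v w → (∀ x, G.Adj v x → x = w) → P v w ∨ P w v := by
    intro v w h hv
    have hv' : ∀ x, G.Adj v x ↔ x = w := fun x => ⟨hv x, by rintro rfl; exact h⟩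
    by_cases hx : ∃ x, x ≠ v ∧ G.Adj w x
    · exact Or.inl ⟨hv', Or.inl hx⟩
    push Not at hx
    rcases edgeSign_mk h.ne with ⟨h1, -⟩ | ⟨-, h1⟩
    · exact Or.inl ⟨hv', Or.inr h1⟩
    · refine Or.inr ⟨fun x => ⟨fun hwx => ?_, by rintro rfl; exact h.symm⟩, Or.inr ?_⟩
      · by_contra hxv
        exact hx x hxv hwx
      · rwa [Sym2.eq_swap]
  refine ⟨Finset.univ.filter fun v => v ∉ U ∧ ∃ w, P v w,
    fun v => if h : ∃ w, P v w then h.choose else v, ?_, ?_⟩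
  · intro l hl
    obtain ⟨hlU, h⟩ := (Finset.mem_filter.1 hl).2
    simp only [dif_pos h]
    refine ⟨hlU, fun hp => ?_, h.choose_spec.1⟩
    obtain ⟨-, y, hy⟩ := (Finset.mem_filter.1 hp).2
    exact hP _ _ h.choose_spec y hy
  · intro v w h hv
    have hw : w ∉ U := fun hw => hv (hU _ _ h.symm hw)
    have : P v w ∨ P w v := by
      rcases hstar v w h hv with h' | h'
      · exact hP' v w h h'
      · exact (hP' w v h.symm h').symm
    rcases this with h' | h'
    · exact Or.inl (by simpa [hv] using ⟨w, h'⟩)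
    · exact Or.inr (by simpa [hw] using ⟨v, h'⟩)

theorem vertexSum_eq_weightedSum (g : Sym2 V → ℤ) {A : Finset (Sym2 V)} (hA : A ⊆ G.edgeFinset)
    {v : V} (hv : ∀ w, G.Adj v w → s(v, w) ∈ A) : vertexSum G g v = weightedSum 0 A g v := by
  rw [vertexSum, weightedSum, Pi.zero_apply, zero_add,
    ← Finset.sum_image (s := G.neighborFinset v) (g := fun w => s(v, w))
      (f := fun e => g e * edgeSign e v) (fun x _ y _ h => Sym2.congr_right.1 h)]
  refine Finset.sum_subset ?_ fun e he he' => ?_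
  · intro e he
    obtain ⟨w, hw, rfl⟩ := Finset.mem_image.1 he
    exact hv w (by simpa using hw)
  · rw [edgeSign_of_notMem, mul_zero]
    rintro ⟨w, rfl⟩
    exact he' (Finset.mem_image_of_mem _ (by simpa using hA he))

/-- A labeling of the edges of a star forest, with exactly one leaf in `Lf` on each edge. -/
theorem exists_star_forest_labeling {U Lf : Finset V} {par : V → V}
    (hleaf : ∀ l ∈ Lf, l ∉ U ∧ par l ∉ Lf ∧ ∀ x, G.Adj l x ↔ x = par l)
    (hedge : ∀ v w, G.Adj v w → v ∉ U → v ∈ Lf ∨ w ∈ Lf) :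
    ∃ g : Sym2 V → ℤ, (∀ l ∈ Lf, (g s(l, par l)).natAbs ∈ Finset.Icc 1 Lf.card) ∧
      Set.InjOn (fun l => (g s(l, par l)).natAbs) Lf ∧
      ∀ v w, v ≠ w → v ∉ U → w ∉ U → (∃ x, G.Adj v x) → (∃ x, G.Adj w x) →
        vertexSum G g v ≠ vertexSum G g w := by
  obtain ⟨r, hr, hrinj, hrsum⟩ := exists_star_labels Lf par
  have hadj : ∀ l ∈ Lf, G.Adj l (par l) := fun l hl => ((hleaf l hl).2.2 _).2 rfl
  have hdiag : ∀ l ∈ Lf, ¬ s(l, par l).IsDiag := fun l hl => by simpa using (hadj l hl).ne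
  let g : Sym2 V → ℤ := fun e => ∑ l ∈ Lf, if e = s(l, par l) then r l * edgeSign e l else 0
  have hg : ∀ l ∈ Lf, g s(l, par l) = r l * edgeSign s(l, par l) l := by
    intro l hl
    refine (Finset.sum_eq_single_of_mem l hl fun l' hl' hne => if_neg fun h => ?_).trans (if_pos rfl)
    rcases Sym2.eq_iff.1 h with ⟨h1, -⟩ | ⟨h1, -⟩
    · exact hne h1.symm
    · exact (hleaf l' hl').2.1 (h1 ▸ hl)
  have habs : ∀ l ∈ Lf, (g s(l, par l)).natAbs = r l := fun l hl => by
    rw [hg l hl, natAbs_mul_edgeSign (hdiag l hl) (by simp), Int.natAbs_natCast]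
  have hsl : ∀ l ∈ Lf, vertexSum G g l = r l := by
    intro l hl
    have : G.neighborFinset l = {par l} := by
      ext x
      simpa using (hleaf l hl).2.2 x
    rw [vertexSum, this, Finset.sum_singleton, hg l hl, mul_assoc,
      edgeSign_mul_self (hdiag l hl) (by simp), mul_one]
  have hcen : ∀ c, c ∉ U → c ∉ Lf → G.neighborFinset c = {l ∈ Lf | par l = c} := by
    intro c hcU hc
    ext x
    rw [SimpleGraph.mem_neighborFinset, Finset.mem_filter]
    constructor
    · intro h
      have hx := (hedge c x h hcU).resolve_left hc
      exact ⟨hx, (((hleaf x hx).2.2 c).1 h.symm).symm⟩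
    · rintro ⟨hx, rfl⟩
      exact (hadj x hx).symm
  have hsc : ∀ c, c ∉ U → c ∉ Lf → vertexSum G g c = -((∑ l ∈ Lf with par l = c, r l : ℕ) : ℤ) := by
    intro c hcU hc
    rw [vertexSum, hcen c hcU hc, Nat.cast_sum, ← Finset.sum_neg_distrib]
    refine Finset.sum_congr rfl fun l hl => ?_
    obtain ⟨hl', rfl⟩ := Finset.mem_filter.1 hl
    rw [Sym2.eq_swap, hg l hl', edgeSign_right (hadj l hl').ne, mul_assoc, mul_neg,
      edgeSign_mul_self (hdiag l hl') (by simp)]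
    ring
  have hneg : ∀ c, c ∉ U → c ∉ Lf → ∀ l ∈ Lf, vertexSum G g l ≠ vertexSum G g c := by
    intro c hcU hc l hl
    rw [hsl l hl, hsc c hcU hc]
    have := (hr l hl).1
    omega
  refine ⟨g, fun l hl => ?_, fun l hl l' hl' h => ?_, fun v w hne hv hw hv' hw' => ?_⟩
  · rw [habs l hl]
    exact Finset.mem_Icc.2 (hr l hl)
  · simp only [habs l hl, habs l' hl'] at h
    exact hrinj hl hl' h
  · by_cases h1 : v ∈ Lf <;> by_cases h2 : w ∈ Lf
    · rw [hsl v h1, hsl w h2]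
      exact fun h => hne (hrinj h1 h2 (by exact_mod_cast h))
    · exact hneg w hw h2 v h1
    · exact (hneg v hv h1 w h2).symm
    · rw [hsc v hv h1, hsc w hw h2]
      have hn : ∀ c, c ∉ U → c ∉ Lf → (∃ x, G.Adj c x) → {l ∈ Lf | par l = c}.Nonempty := by
        rintro c hcU hc ⟨x, hx⟩
        exact ⟨x, hcen c hcU hc ▸ by simpa using hx⟩
      have := hrsum v w hne (hn v hv h1 hv') (hn w hw h2 hw')
      omega

end Graph

/-- Every graph on `n` vertices admits an orientation that is
`⌊2n/3⌋`-quasi-oriented-antimagic. -/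
theorem statement_5 {V : Type*} [Fintype V] (G : SimpleGraph V) :
    HasQuasiOrientedAntimagicOrientation G ((2 * Fintype.card V) / 3) := by
  classical
  set k := 2 * Fintype.card V / 3 with hk
  obtain ⟨A, U, hAG, hA, hc, hin, hout⟩ :=
    exists_completable_of_star_complement G (n := Fintype.card V) (k := k) (by omega)
  obtain ⟨Lf, par, hleaf, hedge⟩ := exists_leaves G (fun v w h hv => (hin v w h hv).1) hout
  obtain ⟨gs, hgs, hgsinj, hgsum⟩ := exists_star_forest_labeling G hleaf hedge
  have hadj : ∀ l ∈ Lf, G.Adj l (par l) := fun l hl => ((hleaf l hl).2.2 _).2 rfl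
  have hnotin : ∀ l ∈ Lf, s(l, par l) ∉ A := fun l hl h =>
    (hleaf l hl).1 ((hA _ h).2 l (by simp))
  have hE : ∀ e ∈ G.edgeFinset, e ∉ A → ∃ l ∈ Lf, s(l, par l) = e := by
    intro e he heA
    induction e with | _ v w
    have h : G.Adj v w := by simpa using he
    have hleaf' : ∀ l x, l ∈ Lf → G.Adj l x → s(l, par l) = s(l, x) := fun l x hl hx => by
      rw [((hleaf l hl).2.2 x).1 hx]
    rcases hedge v w h fun hv => heA (hin v w h hv).2 with hv | hw
    · exact ⟨v, hv, hleaf' v w hv h⟩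
    · exact ⟨w, hw, (hleaf' w v hw h.symm).trans Sym2.eq_swap⟩
  have hm : A.card + Lf.card ≤ G.edgeFinset.card := by
    rw [← Finset.card_image_of_injOn (s := Lf) (f := fun l => s(l, par l))
      (fun l hl l' hl' h => hgsinj hl hl' (by simp only at h ⊢; rw [h])),
      ← Finset.card_union_of_disjoint]
    · refine Finset.card_le_card (Finset.union_subset hAG fun e he => ?_)
      obtain ⟨l, hl, rfl⟩ := Finset.mem_image.1 he
      simpa using hadj l hl
    · rw [Finset.disjoint_right]
      intro e he
      obtain ⟨l, hl, rfl⟩ := Finset.mem_image.1 he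
      exact hnotin l hl
  obtain ⟨g, hg, hginj, hgU, hgF⟩ := hc 0 (Uᶜ.image (vertexSum G gs))
    (Finset.Icc (Lf.card + 1) (G.edgeFinset.card + k)) (by simp)
    (by
      have h1 : (Uᶜ.image (vertexSum G gs)).card ≤ Uᶜ.card := Finset.card_image_le
      rw [Finset.card_compl] at h1
      have := Finset.card_le_univ U
      omega)
    (by rw [Nat.card_Icc]; omega)
  have e1 : ∀ e ∈ A, (if e ∈ A then g e else gs e) = g e := fun e he => if_pos he
  have e2 : ∀ e ∉ A, (if e ∈ A then g e else gs e) = gs e := fun e he => if_neg he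
  have s1 : ∀ v ∈ U, vertexSum G (fun e => if e ∈ A then g e else gs e) v =
      weightedSum 0 A g v := fun v hv => by
    rw [← vertexSum_eq_weightedSum G g hAG fun w hw => (hin v w hw hv).2]
    exact vertexSum_congr G fun w hw => e1 _ (hin v w hw hv).2
  have s2 : ∀ v ∉ U, vertexSum G (fun e => if e ∈ A then g e else gs e) v = vertexSum G gs v :=
    fun v hv => vertexSum_congr G fun w hw => e2 _ fun h => hv ((hA _ h).2 v (by simp))
  have hcross : ∀ u ∈ U, ∀ w ∉ U, weightedSum 0 A g u ≠ vertexSum G gs w := fun u hu w hw h =>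
    hgF u hu (h ▸ Finset.mem_image_of_mem _ (by simpa using hw))
  refine .of_signed G (fun e => if e ∈ A then g e else gs e) ?_ ?_ ?_
  · intro e he
    by_cases heA : e ∈ A
    · simp only [e1 e heA]
      have := hg e heA
      simp only [Finset.mem_Icc] at this ⊢
      omega
    · simp only [e2 e heA]
      obtain ⟨l, hl, rfl⟩ := hE e he heA
      have := hgs l hl
      simp only [Finset.mem_Icc] at this ⊢
      omega
  · have hne : ∀ e ∈ A, ∀ l ∈ Lf, (g e).natAbs ≠ (gs s(l, par l)).natAbs := fun e he l hl => by
      have h1 := hg e he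
      have h2 := hgs l hl
      simp only [Finset.mem_Icc] at h1 h2
      omega
    intro e he e' he' h
    by_cases h1 : e ∈ A <;> by_cases h2 : e' ∈ A <;> simp only [h1, h2, if_true, if_false] at h
    · exact hginj h1 h2 h
    · obtain ⟨l, hl, rfl⟩ := hE e' he' h2
      exact absurd h (hne e h1 l hl)
    · obtain ⟨l, hl, rfl⟩ := hE e he h1
      exact absurd h.symm (hne e' h2 l hl)
    · obtain ⟨l, hl, rfl⟩ := hE e he h1
      obtain ⟨l', hl', rfl⟩ := hE e' he' h2
      rw [hgsinj hl hl' h]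
  · intro u w huw hu hw
    by_cases h1 : u ∈ U <;> by_cases h2 : w ∈ U
    · rw [s1 u h1, s1 w h2]
      exact fun h => huw (hgU h1 h2 h)
    · rw [s1 u h1, s2 w h2]
      exact hcross u h1 w h2
    · rw [s2 u h1, s1 w h2]
      exact (hcross w h2 u h1).symm
    · rw [s2 u h1, s2 w h2]
      exact hgsum u w huw h1 h2 hu hw
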